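/- Let F be a forest (a finite simple acyclic graph) on at most 13 vertices, with at least 2 vertices. Then f(F) ≤ 2. -/

import Mathlib

open Finset

variable {V : Type*}

open scoped Classical in
/-- Degree of `v` in the subgraph of `G` induced on the vertex set `A`
(number of neighbours of `v` inside `A`). -/
noncomputable def degOn (G : SimpleGraph V) (A : Finset V) (v : V) : ℕ :=
  (A.filter fun w => G.Adj v w).card

/-- Maximum degree of the subgraph of `G` induced on `A`. -/
noncomputable def maxDegOn (G : SimpleGraph V) (A : Finset V) : ℕ :=
  A.sup (degOn G A)

open scoped Classical in
/-- The subgraph of `G` induced on `A` has fewer than `k` vertices or at least `k`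
vertices realising its maximum degree. -/
def equates (G : SimpleGraph V) (k : ℕ) (A : Finset V) : Prop :=
  A.card < k ∨ k ≤ (A.filter fun v => degOn G A v = maxDegOn G A).card

open scoped Classical in
/-- `f_k` of the subgraph of `G` induced on `A`: the minimum number of vertices of `A`
whose deletion leaves an induced subgraph with fewer than `k` vertices or with at
least `k` vertices realising its maximum degree. -/
noncomputable def fkOn (G : SimpleGraph V) (k : ℕ) (A : Finset V) : ℕ :=
  sInf {m | ∃ S, S ⊆ A ∧ S.card = m ∧ equates G k (A \ S)}

/-- `f_k(G)`. -/
noncomputable def fk [Fintype V] (G : SimpleGraph V) (k : ℕ) : ℕ :=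
  fkOn G k Finset.univ

/-- `diff` of the subgraph of `G` induced on `A`: the largest degree minus the
second-largest degree (with multiplicity) of this subgraph. -/
noncomputable def diffOn (G : SimpleGraph V) (A : Finset V) : ℕ :=
  maxDegOn G A - ((A.val.map (degOn G A)).erase (maxDegOn G A)).sup

/-- `diff(G) = d₁ - d₂`, the difference between the largest and second-largest
vertex degrees of `G`. -/
noncomputable def diffDeg [Fintype V] (G : SimpleGraph V) : ℕ :=
  diffOn G Finset.univ

open scoped Classical in
lemma h_common (G : SimpleGraph V) (hG : G.IsAcyclic) {a b x y : V} (hab : a ≠ b)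
    (hx : G.Adj a x) (hy : G.Adj a y) (hx' : x = b ∨ G.Adj b x) (hy' : y = b ∨ G.Adj b y) :
    x = y := by
  have key : ∀ z, G.Adj a z → (z = b ∨ G.Adj b z) →
      ∃ p : G.Path a b, p.1.snd = z := by
    intro z hz hz'
    rcases hz' with rfl | hz'
    · exact ⟨⟨SimpleGraph.Walk.cons hz .nil, by simp [hz.ne]⟩, by simp⟩
    · exact ⟨⟨SimpleGraph.Walk.cons hz (.cons hz'.symm .nil), by
        simp [hz.ne, hz'.ne', hab]⟩, by simp⟩
  obtain ⟨p, hp⟩ := key x hx hx'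
  obtain ⟨q, hq⟩ := key y hy hy'
  rw [← hp, ← hq, (hG.subsingleton_path a b).elim p q]

open scoped Classical in
lemma h_mono (G : SimpleGraph V) {A B : Finset V} (h : A ⊆ B) (v : V) :
    degOn G A v ≤ degOn G B v := by
  unfold degOn
  exact card_le_card (filter_subset_filter _ h)

open scoped Classical in
lemma h_gap (G : SimpleGraph V) (hG : G.IsAcyclic) (A : Finset V) (m : ℕ) (a : V) (ha : a ∈ A)
    (hmax : ∀ v ∈ A, degOn G A v ≤ degOn G A a)
    (hbad : ∀ S ⊆ A, S.card ≤ m → ¬ equates G 2 (A \ S)) :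
    ∀ b ∈ A, b ≠ a → degOn G A b + m + 1 ≤ degOn G A a := by
  intro b0 hb0 hb0a
  obtain ⟨b, hb, hbmax⟩ := (A.erase a).exists_max_image (degOn G A) ⟨b0, by simp [*]⟩
  have hbA : b ∈ A := mem_of_mem_erase hb
  have hba : b ≠ a := ne_of_mem_erase hb
  by_contra hcon
  have h1 : degOn G A b0 ≤ degOn G A b := hbmax b0 (by simp [*])
  have hle := hmax b hbA
  have hpos : degOn G A b = 0 → degOn G A a = 0 := by
    intro h0
    by_contra hne
    obtain ⟨w, hw⟩ := card_pos.1 (Nat.pos_of_ne_zero hne)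
    rw [mem_filter] at hw
    have h2 := hbmax w (by simp [hw.1, hw.2.ne'])
    have : 0 < degOn G A w := card_pos.2 ⟨a, by simp [ha, hw.2.symm]⟩
    omega
  set N := A.filter fun w => G.Adj a w with hN
  set T := N.filter fun w => w = b ∨ G.Adj b w with hT
  have hT1 : T.card ≤ 1 := by
    rw [card_le_one]
    intro x hx y hy
    simp only [hT, hN, mem_filter] at hx hy
    exact h_common G hG hba.symm hx.1.2 hy.1.2 hx.2 hy.2
  have hNc : N.card = degOn G A a := rfl
  have hsd : (N \ T).card = N.card - T.card := card_sdiff_of_subset (filter_subset _ _)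
  obtain ⟨S, hS, hSc⟩ := exists_subset_card_eq (s := N \ T)
    (n := degOn G A a - degOn G A b) (by omega)
  have hS' : ∀ x ∈ S, x ∈ A ∧ G.Adj a x ∧ x ≠ b ∧ ¬ G.Adj b x := by
    intro x hx
    have := hS hx
    simp only [hT, hN, mem_filter, mem_sdiff] at this
    tauto
  refine hbad S (fun x hx => (hS' x hx).1) (by omega) (Or.inr ?_)
  have haS : a ∈ A \ S := mem_sdiff.2 ⟨ha, fun h => (hS' a h).2.1.ne rfl⟩
  have hbS : b ∈ A \ S := mem_sdiff.2 ⟨hbA, fun h => (hS' b h).2.2.1 rfl⟩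
  have hdb : degOn G (A \ S) b = degOn G A b := by
    unfold degOn
    congr 1
    ext x
    simp only [mem_filter, mem_sdiff]
    have := hS' x
    tauto
  have hda : degOn G (A \ S) a = degOn G A b := by
    have : (A \ S).filter (fun w => G.Adj a w) = N \ S := by
      ext x; simp only [hN, mem_filter, mem_sdiff]; tauto
    have h3 : degOn G (A \ S) a = (N \ S).card := by unfold degOn; rw [this]
    rw [h3, card_sdiff_of_subset (hS.trans sdiff_subset)]
    omega
  have hM : maxDegOn G (A \ S) = degOn G A b := by
    apply le_antisymm
    · refine Finset.sup_le fun v hv => ?_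
      by_cases hva : v = a
      · rw [hva, hda]
      · exact (h_mono G sdiff_subset v).trans
          (hbmax v (mem_erase.2 ⟨hva, (mem_sdiff.1 hv).1⟩))
    · rw [← hdb]; exact Finset.le_sup hbS
  have : ({a, b} : Finset V) ⊆ (A \ S).filter fun v => degOn G (A \ S) v = maxDegOn G (A \ S) := by
    intro x hx
    simp only [mem_insert, mem_singleton] at hx
    rcases hx with rfl | rfl
    · simp only [mem_filter]; exact ⟨haS, by rw [hda, hM]⟩
    · simp only [mem_filter]; exact ⟨hbS, by rw [hdb, hM]⟩
  calc 2 = ({a, b} : Finset V).card := (card_pair hba.symm).symm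
    _ ≤ _ := card_le_card this

open scoped Classical in
lemma h_edges [Fintype V] (G : SimpleGraph V) (hG : G.IsAcyclic) [Nonempty V] (a b c : V)
    (hba : b ≠ a) (hca : c ≠ a) (hcb : c ≠ b) :
    degOn G univ a + degOn G (univ \ {a}) b + degOn G ((univ \ {a}) \ {b}) c + 1
      ≤ Fintype.card V := by
  obtain ⟨T, hGT, -, hT⟩ :=
    SimpleGraph.Connected.exists_isTree_le_of_le_of_isAcyclic
      (SimpleGraph.connected_top (V := V)) (le_top : G ≤ ⊤) hG
  have hcard := hT.card_edgeFinset
  set f : V → Finset V → Finset (Sym2 V) := fun v A =>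
    (A.filter fun w => G.Adj v w).image (fun w => s(v, w)) with hf
  have hfc : ∀ v A, (f v A).card = degOn G A v := by
    intro v A
    rw [hf]
    exact card_image_of_injective _ (fun x y h => by simp at h; grind)
  have hsub : f a univ ∪ f b (univ \ {a}) ∪ f c ((univ \ {a}) \ {b}) ⊆ T.edgeFinset := by
    have key : ∀ v A, f v A ⊆ T.edgeFinset := by
      intro v A e he
      simp only [hf, mem_image, mem_filter] at he
      obtain ⟨w, ⟨_, hw⟩, rfl⟩ := he
      simpa using hGT hw
    exact union_subset (union_subset (key _ _) (key _ _)) (key _ _)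
  have h := card_le_card hsub
  rw [card_union_of_disjoint, card_union_of_disjoint, hfc, hfc, hfc] at h
  · omega
  · rw [disjoint_left]
    intro e h1 h2
    simp only [hf, mem_image, mem_filter, mem_sdiff, mem_singleton] at h1 h2
    obtain ⟨w, hw, rfl⟩ := h1
    obtain ⟨w', hw', h⟩ := h2
    simp only [Sym2.eq_iff] at h
    grind
  · rw [disjoint_left]
    intro e h1 h2
    simp only [hf, mem_image, mem_filter, mem_sdiff, mem_singleton, mem_union] at h1 h2
    obtain ⟨w', hw', rfl⟩ := h2
    rcases h1 with ⟨w, hw, h⟩ | ⟨w, hw, h⟩ <;> simp only [Sym2.eq_iff] at h <;> grind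

/-- If `F` is a forest on at most 13 (and at least 2) vertices,
then `f(F) ≤ 2`. -/
theorem stmt10 {V : Type*} [Fintype V] (F : SimpleGraph V) (hF : F.IsAcyclic)
    (hn2 : 2 ≤ Fintype.card V) (hn13 : Fintype.card V ≤ 13) :
    fk F 2 ≤ 2 := by
  classical
  by_contra hcon
  have hbad : ∀ S ⊆ (univ : Finset V), S.card ≤ 2 → ¬ equates F 2 (univ \ S) := by
    intro S hS hc he
    apply hcon
    have : fk F 2 ≤ S.card := by
      unfold fk fkOn
      refine Nat.sInf_le ⟨S, hS, rfl, ?_⟩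
      convert he
    omega
  have hne : Nonempty V := Fintype.card_pos_iff.1 (by omega)
  obtain ⟨a, ha, hamax⟩ := (univ : Finset V).exists_max_image (degOn F univ) univ_nonempty
  have g1 := h_gap F hF univ 2 a ha hamax (fun S hS hc => by convert hbad S hS hc)
  have hbad1 : ∀ S ⊆ univ \ {a}, S.card ≤ 1 → ¬ equates F 2 ((univ \ {a}) \ S) := by
    intro S hS hc he
    refine hbad ({a} ∪ S) (subset_univ _) ?_ (by rwa [sdiff_sdiff_left] at he)
    have := card_union_le {a} S
    rw [card_singleton] at this
    omega
  have hcA : (univ \ {a} : Finset V).card = Fintype.card V - 1 := by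
    rw [card_sdiff_of_subset (subset_univ _)]; simp
  obtain ⟨b, hb, hbmax⟩ := (univ \ {a} : Finset V).exists_max_image (degOn F (univ \ {a}))
    (card_pos.1 (by omega))
  have hba : b ≠ a := by simpa using hb
  have g2 := h_gap F hF _ 1 b hb hbmax (fun S hS hc => by convert hbad1 S hS hc)
  have hbad2 : ∀ S ⊆ (univ \ {a}) \ {b}, S.card ≤ 0 →
      ¬ equates F 2 (((univ \ {a}) \ {b}) \ S) := by
    intro S hS hc he
    have hS0 : S = ∅ := by simpa using hc
    subst hS0
    exact hbad1 {b} (by simpa using hba) (by simp) (by simpa using he)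
  have h2 : 2 ≤ ((univ \ {a}) \ {b} : Finset V).card := by
    by_contra h
    refine hbad2 ∅ (empty_subset _) (by simp) (Or.inl ?_)
    rw [sdiff_empty]
    omega
  obtain ⟨c, hc, hcmax⟩ := ((univ \ {a}) \ {b} : Finset V).exists_max_image
    (degOn F ((univ \ {a}) \ {b})) (card_pos.1 (by omega))
  have hc' : c ≠ a ∧ c ≠ b := by simpa using hc
  have g3 := h_gap F hF _ 0 c hc hcmax (fun S hS hc => by convert hbad2 S hS hc)
  obtain ⟨v, hv, hvc⟩ := exists_mem_ne (show 1 < ((univ \ {a}) \ {b} : Finset V).card by omega) c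
  have h3 := g3 v hv hvc
  obtain ⟨w, hw⟩ := card_pos.1 (show 0 < degOn F ((univ \ {a}) \ {b}) c by omega)
  rw [mem_filter] at hw
  have h4 := g3 w hw.1 hw.2.ne'
  have h5 : 0 < degOn F ((univ \ {a}) \ {b}) w := by
    unfold degOn
    exact card_pos.2 ⟨c, by rw [mem_filter]; exact ⟨hc, hw.2.symm⟩⟩
  have h6 := h_mono F (sdiff_subset : (univ \ {a}) \ {b} ⊆ univ \ {a}) c
  have h7 := g2 c (by simpa using hc'.1) hc'.2
  have h8 := h_mono F (subset_univ (univ \ {a})) b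
  have h9 := g1 b (mem_univ _) hba
  have h10 := h_edges F hF a b c hba hc'.1 hc'.2
  have e1 : degOn F (univ \ {a}) b + degOn F ((univ \ {a}) \ {b}) c + degOn F univ a + 1
      ≤ Fintype.card V := by
    convert h10 using 2
    ring
  omega
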